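/- Let F(x) := ∫₀ˣ (1−t⁶)^{−1/2} dt, k² := (2−√3)/4, φ(x) := (1−(√3+1)x²)/(1+(√3−1)x²), and ψ(y) := √( (1−y) / ((√3+1)+(√3−1)y) ) (so ψ is the inverse of φ from [−1,1] to [0,1]). For all U, V ∈ [0,1] with F(U) + F(V) ≤ F(1), set N := φ(U)φ(V) − √( (1−φ(U)²)(1−φ(V)²)(1−k²(1−φ(U)²))(1−k²(1−φ(V)²)) ) and D := 1 − k²(1−φ(U)²)(1−φ(V)²). Then N/D ∈ [−1,1] and F( ψ(N/D) ) = F(U) + F(V). (This is the addition formula for sin_{2,6} obtained from the addition formula for the Jacobian elliptic function cn.) -/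

import Mathlib

/-- `F = F_{2,6}`, the incomplete integral `∫₀ˣ (1−t⁶)^{−1/2} dt`. -/
noncomputable def F26 (x : ℝ) : ℝ := ∫ t in (0:ℝ)..x, (1 - t ^ 6) ^ (-(1/2) : ℝ)

/-- The rational map `φ` linking `sin_{2,6}` to the Jacobian elliptic function `cn`. -/
noncomputable def phi26 (x : ℝ) : ℝ :=
  (1 - (Real.sqrt 3 + 1) * x ^ 2) / (1 + (Real.sqrt 3 - 1) * x ^ 2)

/-- The inverse `ψ` of `φ` from `[−1,1]` to `[0,1]`. -/
noncomputable def psi26 (y : ℝ) : ℝ :=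
  Real.sqrt ((1 - y) / ((Real.sqrt 3 + 1) + (Real.sqrt 3 - 1) * y))

noncomputable def mm : ℝ := (2 - Real.sqrt 3) / 4

lemma s3_sq : Real.sqrt 3 ^ 2 = 3 := Real.sq_sqrt (by norm_num)
lemma s3_gt : 1 < Real.sqrt 3 := by
  have := s3_sq; have := Real.sqrt_nonneg 3; nlinarith
lemma s3_lt : Real.sqrt 3 < 2 := by
  have := s3_sq; have := Real.sqrt_nonneg 3; nlinarith
lemma mm_pos : 0 < mm := by unfold mm; have := s3_lt; linarith
lemma mm_lt : mm < 1 := by unfold mm; have := s3_gt; linarith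

lemma den_pos (t : ℝ) : 0 < 1 - mm * Real.sin t ^ 2 := by
  have := mm_pos; have := mm_lt; have := Real.sin_sq_le_one t
  nlinarith [sq_nonneg (Real.sin t)]

noncomputable def gi (t : ℝ) : ℝ := 1 / Real.sqrt (1 - mm * Real.sin t ^ 2)

lemma gi_cont : Continuous gi := by
  unfold gi
  refine continuous_const.div (by fun_prop) (fun t => (Real.sqrt_pos.2 (den_pos t)).ne')

lemma gi_ge (t : ℝ) : 1 ≤ gi t := by
  unfold gi
  rw [le_div_iff₀ (Real.sqrt_pos.2 (den_pos t)), one_mul, Real.sqrt_le_one]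
  have := mm_pos; nlinarith [sq_nonneg (Real.sin t)]

noncomputable def GG (x : ℝ) : ℝ := ∫ t in (0:ℝ)..x, gi t

lemma GG_deriv (x : ℝ) : HasDerivAt GG (gi x) x :=
  intervalIntegral.integral_hasDerivAt_right (gi_cont.intervalIntegrable _ _)
    (gi_cont.stronglyMeasurableAtFilter _ _) gi_cont.continuousAt

lemma GG_zero : GG 0 = 0 := by simp [GG]

lemma GG_cont : Continuous GG :=
  continuous_iff_continuousAt.2 fun x => (GG_deriv x).continuousAt

lemma GG_mono : StrictMono GG :=
  strictMono_of_hasDerivAt_pos GG_deriv fun x => lt_of_lt_of_le one_pos (gi_ge x)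

lemma GG_sub_mono : Monotone (fun x => GG x - x) :=
  monotone_of_hasDerivAt_nonneg (fun x => (GG_deriv x).sub (hasDerivAt_id x))
    fun x => by have := gi_ge x; simp; linarith

lemma GG_surj : Function.Surjective GG := by
  refine GG_cont.surjective ?_ ?_
  · refine Filter.tendsto_atTop_mono' _ ?_ Filter.tendsto_id
    filter_upwards [Filter.eventually_ge_atTop 0] with x hx
    have := GG_sub_mono hx
    simp [GG_zero] at this; simpa using this
  · refine Filter.tendsto_atBot_mono' _ ?_ Filter.tendsto_id
    filter_upwards [Filter.eventually_le_atBot 0] with x hx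
    have := GG_sub_mono hx
    simp [GG_zero] at this; simpa using this

noncomputable def GI : ℝ ≃o ℝ := GG_mono.orderIsoOfSurjective GG GG_surj

noncomputable def am (u : ℝ) : ℝ := GI.symm u

lemma GG_am (u : ℝ) : GG (am u) = u := GI.apply_symm_apply u
lemma am_GG (x : ℝ) : am (GG x) = x := GI.symm_apply_apply x
lemma am_cont : Continuous am := GI.symm.continuous

noncomputable def dn (u : ℝ) : ℝ := Real.sqrt (1 - mm * Real.sin (am u) ^ 2)

lemma dn_pos (u : ℝ) : 0 < dn u := Real.sqrt_pos.2 (den_pos _)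
lemma dn_sq (u : ℝ) : dn u ^ 2 = 1 - mm * Real.sin (am u) ^ 2 :=
  Real.sq_sqrt (den_pos _).le

lemma am_deriv (u : ℝ) : HasDerivAt am (dn u) u := by
  have h := (GG_deriv (am u)).of_local_left_inverse am_cont.continuousAt
    (lt_of_lt_of_le one_pos (gi_ge _)).ne' (Filter.Eventually.of_forall GG_am)
  simpa [gi, dn] using h

lemma sn_deriv (u : ℝ) :
    HasDerivAt (fun u => Real.sin (am u)) (Real.cos (am u) * dn u) u := (am_deriv u).sin
lemma cn_deriv (u : ℝ) :
    HasDerivAt (fun u => Real.cos (am u)) (-Real.sin (am u) * dn u) u := (am_deriv u).cos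
lemma dn_deriv (u : ℝ) :
    HasDerivAt dn (-mm * Real.sin (am u) * Real.cos (am u)) u := by
  have h := ((((sn_deriv u).pow 2).const_mul mm).const_sub 1).sqrt (den_pos (am u)).ne'
  have hd := (dn_pos u).ne'
  refine h.congr_deriv ?_
  change _ / (2 * dn u) = _
  field_simp
  norm_num
  try ring

lemma D_pos (a b : ℝ) : 0 < 1 - mm * Real.sin a ^ 2 * Real.sin b ^ 2 := by
  have h1 := den_pos a
  have h2 := mul_le_mul_of_nonneg_left (Real.sin_sq_le_one b)
    (mul_nonneg mm_pos.le (sq_nonneg (Real.sin a)))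
  linarith

lemma alg (m s c d t e f : ℝ) (h1 : c ^ 2 = 1 - s ^ 2) (h2 : d ^ 2 = 1 - m * s ^ 2)
    (h3 : e ^ 2 = 1 - t ^ 2) (h4 : f ^ 2 = 1 - m * t ^ 2) :
    ((-s * d) * e + c * (t * f) - (((c * d * t + s * (-(e * f))) * d + s * t * (-m * s * c)) * f
        + s * t * d * (m * t * e))) * (1 - m * s ^ 2 * t ^ 2)
     - (c * e - s * t * d * f) * (- (m * (2 * s * (c * d)) * t ^ 2 + m * s ^ 2 * (2 * t * (-(e * f))))) = 0 := by
  grind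

lemma cn_add (x v : ℝ) : Real.cos (am (x + v)) =
    (Real.cos (am x) * Real.cos (am v) - Real.sin (am x) * Real.sin (am v) * dn x * dn v)
      / (1 - mm * Real.sin (am x) ^ 2 * Real.sin (am v) ^ 2) := by
  set r := x + v with hr
  let h : ℝ → ℝ := fun u =>
    (Real.cos (am u) * Real.cos (am (r - u))
        - Real.sin (am u) * Real.sin (am (r - u)) * dn u * dn (r - u))
      / (1 - mm * Real.sin (am u) ^ 2 * Real.sin (am (r - u)) ^ 2)
  have hd : ∀ u, HasDerivAt h 0 u := by
    intro u
    have hs : HasDerivAt (fun u => r - u) (-1) u := (hasDerivAt_id u).const_sub r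
    have s1 := sn_deriv u
    have c1 := cn_deriv u
    have d1 := dn_deriv u
    have s2 : HasDerivAt (fun u => Real.sin (am (r - u))) _ u := (sn_deriv (r - u)).comp u hs
    have c2 : HasDerivAt (fun u => Real.cos (am (r - u))) _ u := (cn_deriv (r - u)).comp u hs
    have d2 : HasDerivAt (fun u => dn (r - u)) _ u := (dn_deriv (r - u)).comp u hs
    have hD := (D_pos (am u) (am (r - u))).ne'
    have H := ((c1.mul c2).sub (((s1.mul s2).mul d1).mul d2)).div
      ((((s1.pow 2).const_mul mm).mul (s2.pow 2)).const_sub 1) hD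
    refine H.congr_deriv ?_
    rw [div_eq_zero_iff]; left
    have A := alg mm (Real.sin (am u)) (Real.cos (am u)) (dn u)
      (Real.sin (am (r - u))) (Real.cos (am (r - u))) (dn (r - u))
      (Real.cos_sq' _) (dn_sq u) (Real.cos_sq' _) (dn_sq _)
    rw [← A]
    simp only [Pi.mul_apply, Pi.sub_apply, Pi.pow_apply]
    norm_num
    try ring
  have hc := is_const_of_deriv_eq_zero (fun u => (hd u).differentiableAt) (fun u => (hd u).deriv)
    0 x
  have h0 : am 0 = 0 := by rw [← GG_zero, am_GG, GG_zero]
  have e0 : h 0 = Real.cos (am r) := by simp [h, h0]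
  have hx : r - x = v := by rw [hr]; ring
  rw [← e0, hc]
  simp only [h, hx]

noncomputable def cc : ℝ := Real.sqrt (4 * Real.sqrt 3)
lemma cc_pos : 0 < cc := Real.sqrt_pos.2 (by have := s3_gt; linarith)
lemma cc_sq : cc ^ 2 = 4 * Real.sqrt 3 := Real.sq_sqrt (by have := s3_gt; linarith)

lemma Q_pos (x : ℝ) : 0 < 1 + (Real.sqrt 3 - 1) * x ^ 2 := by
  have := s3_gt; nlinarith [sq_nonneg x]

lemma phi_deriv (x : ℝ) : HasDerivAt phi26
    (-4 * Real.sqrt 3 * x / (1 + (Real.sqrt 3 - 1) * x ^ 2) ^ 2) x := by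
  have h1 := (((hasDerivAt_id x).pow 2).const_mul (Real.sqrt 3 + 1)).const_sub 1
  have h2 := (((hasDerivAt_id x).pow 2).const_mul (Real.sqrt 3 - 1)).const_add 1
  refine (h1.div h2 (Q_pos x).ne').congr_deriv ?_
  simp only [id, Pi.pow_apply]
  congr 1
  norm_num
  ring

lemma one_sub_phi (x : ℝ) : 1 - phi26 x ^ 2 =
    4 * Real.sqrt 3 * x ^ 2 * (1 - x ^ 2) / (1 + (Real.sqrt 3 - 1) * x ^ 2) ^ 2 := by
  have := (Q_pos x).ne'
  unfold phi26
  rw [div_pow, eq_div_iff (by positivity), sub_mul, div_mul_cancel₀ _ (by positivity)]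
  ring

lemma one_sub_m_phi (x : ℝ) : 1 - mm * (1 - phi26 x ^ 2) =
    (1 + x ^ 2 + x ^ 4) / (1 + (Real.sqrt 3 - 1) * x ^ 2) ^ 2 := by
  have := (Q_pos x).ne'
  rw [one_sub_phi, mm]
  rw [← mul_div_assoc, eq_div_iff (by positivity), sub_mul, div_mul_cancel₀ _ (by positivity)]
  linear_combination (x^2) * s3_sq

lemma phi_le {x : ℝ} (hx : x ∈ Set.Icc (0:ℝ) 1) : phi26 x ∈ Set.Icc (-1:ℝ) 1 := by
  have h : 0 ≤ 1 - phi26 x ^ 2 := by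
    rw [one_sub_phi]
    have : 0 ≤ 1 - x ^ 2 := by nlinarith [hx.1, hx.2]
    positivity
  exact abs_le.1 ((sq_le_one_iff_abs_le_one _).1 (by linarith))

lemma phi_lt {x : ℝ} (hx : x ∈ Set.Ioo (0:ℝ) 1) : 0 < 1 - phi26 x ^ 2 := by
  rw [one_sub_phi]
  have : 0 < 1 - x ^ 2 := by nlinarith [hx.1, hx.2]
  have := hx.1
  have := Q_pos x
  have := s3_gt
  positivity

noncomputable def gg (x : ℝ) : ℝ := GG (Real.arccos (phi26 x)) / cc

lemma gg_deriv {x : ℝ} (hx : x ∈ Set.Ioo (0:ℝ) 1) :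
    HasDerivAt gg ((1 - x ^ 6) ^ (-(1/2) : ℝ)) x := by
  have hp := phi_lt hx
  have ha : |phi26 x| < 1 := (sq_lt_one_iff_abs_lt_one _).1 (by linarith)
  rw [abs_lt] at ha
  have h1 := (Real.hasDerivAt_arccos ha.1.ne' ha.2.ne).comp x (phi_deriv x)
  have h2 := ((GG_deriv _).comp x h1).div_const cc
  refine h2.congr_deriv ?_
  have x0 := hx.1
  have hQ := Q_pos x
  have hx6 : 0 < 1 - x ^ 6 := by
    have : x ^ 6 < 1 := pow_lt_one₀ hx.1.le hx.2 (by norm_num)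
    linarith
  have hm : 0 < 1 - mm * (1 - phi26 x ^ 2) := by
    rw [one_sub_m_phi]; positivity
  rw [Real.rpow_neg hx6.le, ← Real.sqrt_eq_rpow]
  have key : Real.sqrt (1 - mm * (1 - phi26 x ^ 2)) * Real.sqrt (1 - phi26 x ^ 2)
      = cc * x * Real.sqrt (1 - x ^ 6) / (1 + (Real.sqrt 3 - 1) * x ^ 2) ^ 2 := by
    have hc := cc_pos
    rw [← Real.sqrt_mul hm.le, Real.sqrt_eq_iff_mul_self_eq (by positivity) (by positivity)]
    rw [one_sub_m_phi, one_sub_phi, div_mul_div_comm, div_mul_div_comm]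
    congr 1
    linear_combination -(x^2 * (1 - x^6)) * cc_sq - cc^2*x^2 * Real.sq_sqrt hx6.le
  simp only [gi, Function.comp, Real.sin_arccos]
  rw [Real.sq_sqrt hp.le]
  have hs1 := Real.sqrt_pos.2 hm
  have hs2 := Real.sqrt_pos.2 hp
  have hs3 := Real.sqrt_pos.2 hx6
  have hc := cc_pos
  have e : ∀ a b q c : ℝ, 1 / a * (-(1 / b) * q) / c = - q / ((a * b) * c) := by
    intros; ring
  rw [e, key]
  clear h1 h2 key
  generalize 1 + (Real.sqrt 3 - 1) * x ^ 2 = q at hQ ⊢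
  field_simp
  linear_combination - cc_sq

lemma F_eq {x : ℝ} (hx : x ∈ Set.Icc (0:ℝ) 1) : F26 x = gg x := by
  have hcont : Continuous gg := by
    have : Continuous phi26 := continuous_iff_continuousAt.2 fun x => (phi_deriv x).continuousAt
    exact (GG_cont.comp (Real.continuous_arccos.comp this)).div_const _
  have hd : ∀ t ∈ Set.Ioo (0:ℝ) x, HasDerivAt gg ((1 - t ^ 6) ^ (-(1/2) : ℝ)) t :=
    fun t ht => gg_deriv ⟨ht.1, ht.2.trans_le hx.2⟩
  have hint := intervalIntegral.integrableOn_deriv_of_nonneg hcont.continuousOn hd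
    (fun t ht => Real.rpow_nonneg (by
      have : t ^ 6 ≤ 1 := pow_le_one₀ ht.1.le (ht.2.le.trans hx.2)
      linarith) _)
  have h := intervalIntegral.integral_eq_sub_of_hasDerivAt_of_le hx.1 hcont.continuousOn hd
    ((intervalIntegrable_iff_integrableOn_Ioc_of_le hx.1).2 hint)
  have h0 : gg 0 = 0 := by simp [gg, phi26, GG_zero]
  rw [F26, h, h0, sub_zero]

lemma psi_mem {y : ℝ} (hy : y ∈ Set.Icc (-1:ℝ) 1) : psi26 y ∈ Set.Icc (0:ℝ) 1 := by
  have := s3_gt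
  refine ⟨Real.sqrt_nonneg _, ?_⟩
  have hd : 0 < (Real.sqrt 3 + 1) + (Real.sqrt 3 - 1) * y := by nlinarith [hy.1, hy.2]
  rw [psi26, Real.sqrt_le_one, div_le_one hd]
  nlinarith [hy.1, hy.2]

lemma phi_psi {y : ℝ} (hy : y ∈ Set.Icc (-1:ℝ) 1) : phi26 (psi26 y) = y := by
  have := s3_gt
  have hd : 0 < (Real.sqrt 3 + 1) + (Real.sqrt 3 - 1) * y := by nlinarith [hy.1, hy.2]
  have hn : 0 ≤ 1 - y := by linarith [hy.2]
  have hq := Q_pos (psi26 y)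
  have hs : psi26 y ^ 2 * ((Real.sqrt 3 + 1) + (Real.sqrt 3 - 1) * y) = 1 - y := by
    rw [psi26, Real.sq_sqrt (by positivity), div_mul_cancel₀ _ hd.ne']
  rw [phi26, div_eq_iff hq.ne']
  linear_combination -hs

lemma main_aux (U V : ℝ)
    (hU : U ∈ Set.Icc (0:ℝ) 1) (hV : V ∈ Set.Icc (0:ℝ) 1)
    (hUV : F26 U + F26 V ≤ F26 1) (y : ℝ) (hy : y = ((phi26 U * phi26 V -
        Real.sqrt ((1 - phi26 U ^ 2) * (1 - phi26 V ^ 2)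
          * (1 - mm * (1 - phi26 U ^ 2))
          * (1 - mm * (1 - phi26 V ^ 2))))
      / (1 - mm * (1 - phi26 U ^ 2) * (1 - phi26 V ^ 2)))) :
    y ∈ Set.Icc (-1:ℝ) 1 ∧ F26 (psi26 y) = F26 U + F26 V := by
  have hc := cc_pos
  set a := Real.arccos (phi26 U) with ha
  set b := Real.arccos (phi26 V) with hb
  have hca : Real.cos a = phi26 U := Real.cos_arccos (phi_le hU).1 (phi_le hU).2
  have hcb : Real.cos b = phi26 V := Real.cos_arccos (phi_le hV).1 (phi_le hV).2
  have a0 : 0 ≤ a := Real.arccos_nonneg _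
  have b0 : 0 ≤ b := Real.arccos_nonneg _
  have sa : 0 ≤ Real.sin a := Real.sin_nonneg_of_nonneg_of_le_pi a0 (Real.arccos_le_pi _)
  have sb : 0 ≤ Real.sin b := Real.sin_nonneg_of_nonneg_of_le_pi b0 (Real.arccos_le_pi _)
  have h1 : phi26 1 = -1 := by
    have := s3_gt
    rw [phi26, div_eq_iff (by nlinarith)]; ring
  have hle : GG a + GG b ≤ GG Real.pi := by
    rw [F_eq hU, F_eq hV, F_eq (by simp), gg, gg, gg, h1, Real.arccos_neg_one, ← add_div,
      div_le_div_iff_of_pos_right hc] at hUV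
    exact hUV
  have hyc : y = Real.cos (am (GG a + GG b)) := by
    rw [cn_add, am_GG, am_GG, hca, hcb, hy]
    have e1 : Real.sin a ^ 2 = 1 - phi26 U ^ 2 := by rw [← hca, Real.sin_sq]
    have e2 : Real.sin b ^ 2 = 1 - phi26 V ^ 2 := by rw [← hcb, Real.sin_sq]
    have f1 := dn_sq (GG a)
    have f2 := dn_sq (GG b)
    rw [am_GG] at f1 f2
    rw [← e1, ← e2, ← f1, ← f2]
    congr 2
    have p1 := dn_pos (GG a)
    have p2 := dn_pos (GG b)
    rw [show Real.sin a ^ 2 * Real.sin b ^ 2 * dn (GG a) ^ 2 * dn (GG b) ^ 2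
      = (Real.sin a * Real.sin b * dn (GG a) * dn (GG b)) ^ 2 by ring, Real.sqrt_sq (by positivity)]
  have hyI : y ∈ Set.Icc (-1:ℝ) 1 := by
    rw [hyc]; exact ⟨Real.neg_one_le_cos _, Real.cos_le_one _⟩
  refine ⟨hyI, ?_⟩
  have g0 : GG 0 ≤ GG a := GG_mono.monotone a0
  have g1 : GG 0 ≤ GG b := GG_mono.monotone b0
  rw [GG_zero] at g0 g1
  have w0 : 0 ≤ am (GG a + GG b) := by
    rw [← GG_mono.le_iff_le, GG_am, GG_zero]; linarith
  have w1 : am (GG a + GG b) ≤ Real.pi := by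
    rw [← GG_mono.le_iff_le, GG_am]; exact hle
  rw [F_eq (psi_mem hyI), F_eq hU, F_eq hV, gg, gg, gg, phi_psi hyI, hyc,
    Real.arccos_cos w0 w1, GG_am, add_div]

/-- The addition formula for `sin_{2,6}` coming from the addition formula for `cn`,
with `k² = (2−√3)/4`. -/
theorem addition_formula_sin_two_six (U V : ℝ)
    (hU : U ∈ Set.Icc (0:ℝ) 1) (hV : V ∈ Set.Icc (0:ℝ) 1)
    (hUV : F26 U + F26 V ≤ F26 1) :
    ((phi26 U * phi26 V -
        Real.sqrt ((1 - phi26 U ^ 2) * (1 - phi26 V ^ 2)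
          * (1 - (2 - Real.sqrt 3)/4 * (1 - phi26 U ^ 2))
          * (1 - (2 - Real.sqrt 3)/4 * (1 - phi26 V ^ 2))))
      / (1 - (2 - Real.sqrt 3)/4 * (1 - phi26 U ^ 2) * (1 - phi26 V ^ 2)))
        ∈ Set.Icc (-1:ℝ) 1 ∧
    F26 (psi26 ((phi26 U * phi26 V -
        Real.sqrt ((1 - phi26 U ^ 2) * (1 - phi26 V ^ 2)
          * (1 - (2 - Real.sqrt 3)/4 * (1 - phi26 U ^ 2))
          * (1 - (2 - Real.sqrt 3)/4 * (1 - phi26 V ^ 2))))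
      / (1 - (2 - Real.sqrt 3)/4 * (1 - phi26 U ^ 2) * (1 - phi26 V ^ 2))))
      = F26 U + F26 V := by
  exact main_aux U V hU hV hUV _ rfl
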